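/- arXiv:1603.01817 — 2 statements merged into one kernel-verified Lean document; each statement's English description precedes it below -/
import Mathlib

section
/- If E̊ ∈ [0,1]^Γ is a fixed point of the coupled state evolution (i.e. [T_c(E̊)]_r = E̊_r for r ∉ A and E̊_r = 0 for r ∈ A, where A := {1,…,3w} ∪ {Γ−3w+1,…,Γ}), then the partial derivatives of the coupled potential vanish at E̊ in the bulk: ∂F_c/∂E_r (E̊) = 0 for every r ∈ {3w+1,…,Γ−3w}. -/
open MeasureTheory ProbabilityTheory Filter Finset Real

noncomputable section

/-- Product of `B` i.i.d. standard Gaussians on `Fin B → ℝ` (law of `z`). -/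
def stdGauss (B : ℕ) : Measure (Fin B → ℝ) :=
  Measure.pi fun _ => gaussianReal 0 1

/-- The `j`-th standard basis vector of `ℝ^B` (a section). -/
def basisVec (B : ℕ) (j : Fin B) : Fin B → ℝ := fun k => if k = j then 1 else 0

/-- The MMSE denoiser `f_i(Σ)` of the effective Gaussian channel. -/
def denoiser (B : ℕ) (Sn : ℝ) (s z : Fin B → ℝ) (i : Fin B) : ℝ :=
  (1 + ∑ k ∈ Finset.univ.erase i,
      Real.exp ((s k - s i) * Real.logb 2 B / Sn ^ 2 +
        (z k - z i) * Real.sqrt (Real.logb 2 B) / Sn))⁻¹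

/-- `E_{s,z}[ ∑_{i=1}^B (f_i(Σ) - s_i)^2 ]`, with `s` uniform over the basis vectors
and `z` i.i.d. standard Gaussian: the MMSE of the effective `B`-dimensional channel. -/
def mmseB (B : ℕ) (Sn : ℝ) : ℝ :=
  (B : ℝ)⁻¹ * ∑ j : Fin B,
    ∫ z, (∑ i, (denoiser B Sn (basisVec B j) z i - basisVec B j i) ^ 2) ∂ stdGauss B

/-- Effective noise `Σ(E) = √(R(σ² + E))`. -/
def sigU (R σ2 E : ℝ) : ℝ := Real.sqrt (R * (σ2 + E))

/-- State evolution operator of the underlying system. -/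
def Tu (B : ℕ) (R σ2 E : ℝ) : ℝ := mmseB B (sigU R σ2 E)

/-- Energy term of the underlying potential. -/
def Uu (R σ2 E : ℝ) : ℝ :=
  (1 / (2 * R)) * Real.logb 2 ((σ2 + E) * Real.exp (-(E / (σ2 + E))))

/-- Entropy term of the underlying potential,
`S_u(Σ) = E_z[log_B(1 + ∑_{i=2}^B e_i(Σ))]`. -/
def Su (B : ℕ) (Sn : ℝ) : ℝ :=
  if h : 0 < B then
    letI : NeZero B := ⟨h.ne'⟩
    ∫ z, Real.logb B (1 + ∑ i ∈ Finset.univ.erase (0 : Fin B),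
        Real.exp ((z i - z 0) * Real.sqrt (Real.logb 2 B) / Sn -
          Real.logb 2 B / Sn ^ 2)) ∂ stdGauss B
  else 0

/-- Potential of the underlying system. -/
def Fu (B : ℕ) (R σ2 E : ℝ) : ℝ := Uu R σ2 E - Su B (sigU R σ2 E)

/-- The MSE floor `E₀ = lim_t T_u^{(t)}(0)`. -/
def mseFloor (B : ℕ) (R σ2 : ℝ) : ℝ :=
  limUnder atTop fun t : ℕ => (Tu B R σ2)^[t] 0

/-- Basin of attraction `𝒱₀` of the MSE floor. -/
def basin (B : ℕ) (R σ2 : ℝ) : Set ℝ :=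
  {E | E ∈ Set.Icc (0:ℝ) 1 ∧
    Tendsto (fun t : ℕ => (Tu B R σ2)^[t] E) atTop (nhds (mseFloor B R σ2))}

/-- Free energy gap `ΔF_u` (`+∞` if the complement of the basin is empty). -/
def gapFu (B : ℕ) (R σ2 : ℝ) : EReal :=
  ⨅ E ∈ Set.Icc (0:ℝ) 1 \ basin B R σ2,
    ((Fu B R σ2 E - Fu B R σ2 (mseFloor B R σ2) : ℝ) : EReal)

/-- Potential threshold `R_pot`. -/
def Rpot (B : ℕ) (σ2 : ℝ) : ℝ :=
  sSup {R : ℝ | 0 < R ∧ 0 < gapFu B R σ2}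

/-- Effective noise `Σ_c(E)` of block `c` in the coupled system. -/
def sigC (R σ2 : ℝ) (Γ : ℕ) (J : Fin Γ → Fin Γ → ℝ) (E : Fin Γ → ℝ) (c : Fin Γ) : ℝ :=
  (Real.sqrt ((Γ : ℝ)⁻¹ * ∑ r, J r c / (R * (σ2 + E r))))⁻¹

/-- Coupled state evolution operator `[T_c(E)]_r`. -/
def Tc (B : ℕ) (R σ2 : ℝ) (Γ : ℕ) (J : Fin Γ → Fin Γ → ℝ) (E : Fin Γ → ℝ) (r : Fin Γ) : ℝ :=
  (Γ : ℝ)⁻¹ * ∑ c, J r c * mmseB B (sigC R σ2 Γ J E c)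

/-- Coupled potential `F_c`. -/
def Fc (B : ℕ) (R σ2 : ℝ) (Γ : ℕ) (J : Fin Γ → Fin Γ → ℝ) (E : Fin Γ → ℝ) : ℝ :=
  (∑ r, Uu R σ2 (E r)) - ∑ c, Su B (sigC R σ2 Γ J E c)

/-- Shift operator: `[S(E)]_1 = E₀`, `[S(E)]_r = E_{r-1}` (0-based indexing). -/
def shiftProf (Γ : ℕ) (E0v : ℝ) (E : Fin Γ → ℝ) (r : Fin Γ) : ℝ :=
  if r.1 = 0 then E0v else E ⟨r.1 - 1, lt_of_le_of_lt (Nat.sub_le _ _) r.isLt⟩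

/-- Partial derivative of a function of a profile with respect to coordinate `r`. -/
def pderiv (Γ : ℕ) (F : (Fin Γ → ℝ) → ℝ) (r : Fin Γ) (P : Fin Γ → ℝ) : ℝ :=
  deriv (fun x => F (Function.update P r x)) (P r)

/-- Coupled SE operator with the pinning condition enforced on
`A = {1,…,3w} ∪ {Γ-3w+1,…,Γ}` (in 0-based indexing: `r < 3w` or `r ≥ Γ-3w`). -/
def TcPin (B : ℕ) (R σ2 : ℝ) (Γ w : ℕ) (J : Fin Γ → Fin Γ → ℝ) (E : Fin Γ → ℝ) (r : Fin Γ) : ℝ :=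
  if r.1 < 3*w ∨ Γ - 3*w ≤ r.1 then 0 else Tc B R σ2 Γ J E r

/-- All-ones initial profile, pinned to `0` on the pinning set `A`. -/
def onesPin (Γ w : ℕ) : Fin Γ → ℝ :=
  fun r => if r.1 < 3*w ∨ Γ - 3*w ≤ r.1 then 0 else 1

/-- Large section size (`B → ∞`) limit of the underlying potential. -/
def phiLim (R σ2 E : ℝ) : ℝ :=
  (1/(2*R)) * Real.logb 2 ((σ2 + E) * Real.exp (-(E/(σ2+E)))) -
    max 0 (1 - 1/(2 * Real.log 2 * R * (σ2 + E)))

theorem integrable_mul_gaussianPDFReal {f : ℝ → ℝ} (hf : Integrable f (gaussianReal 0 1)) :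
    Integrable (fun x => gaussianPDFReal 0 1 x * f x) := by
  rw [gaussianReal_of_var_ne_zero _ one_ne_zero,
    integrable_withDensity_iff_integrable_smul' (measurable_gaussianPDF _ _)
      (ae_of_all _ fun _ => gaussianPDF_lt_top)] at hf
  simpa [toReal_gaussianPDF] using hf

theorem hasDerivAt_gaussianPDFReal_zero_one (x : ℝ) :
    HasDerivAt (gaussianPDFReal 0 1) (-(x * gaussianPDFReal 0 1 x)) x := by
  have h : HasDerivAt (fun y : ℝ => -(y - 0) ^ 2 / (2 * ((1 : NNReal) : ℝ))) (-x) x := by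
    have := (((hasDerivAt_id x).sub_const 0).pow 2).neg.div_const (2 * ((1 : NNReal) : ℝ))
    exact this.congr_deriv (by simp; ring)
  have h2 := h.exp.const_mul (√(2 * π * ((1 : NNReal) : ℝ)))⁻¹
  rw [gaussianPDFReal_def]
  refine h2.congr_deriv ?_
  simp only
  ring

/-- Gaussian integration by parts (Stein's lemma) for bounded functions. -/
theorem integral_mul_gaussianReal {f f' : ℝ → ℝ} {C : ℝ}
    (hf : ∀ x, HasDerivAt f (f' x) x) (hf' : Continuous f')
    (hC : ∀ x, |f x| ≤ C) (hC' : ∀ x, |f' x| ≤ C) :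
    ∫ x, x * f x ∂gaussianReal 0 1 = ∫ x, f' x ∂gaussianReal 0 1 := by
  have hcont : Continuous f := continuous_iff_continuousAt.2 fun x => (hf x).continuousAt
  have hid : Integrable (fun x : ℝ => x) (gaussianReal 0 1) :=
    (memLp_id_gaussianReal (μ := 0) (v := 1) 1).integrable (by simp)
  have i1 : Integrable (fun x => x * f x) (gaussianReal 0 1) :=
    hid.mul_bdd (c := C) hcont.aestronglyMeasurable (ae_of_all _ hC)
  have i2 : Integrable f' (gaussianReal 0 1) :=
    Integrable.of_bound hf'.aestronglyMeasurable C (ae_of_all _ hC')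
  have i3 : Integrable f (gaussianReal 0 1) :=
    Integrable.of_bound hcont.aestronglyMeasurable C (ae_of_all _ hC)
  have j1 := integrable_mul_gaussianPDFReal i1
  have j2 := integrable_mul_gaussianPDFReal i2
  have key := integral_eq_zero_of_hasDerivAt_of_integrable
    (fun x => (hasDerivAt_gaussianPDFReal_zero_one x).mul (hf x))
    ((j2.sub j1).congr (ae_of_all _ fun x => by simp only [Pi.sub_apply]; ring))
    (integrable_mul_gaussianPDFReal i3)
  rw [integral_gaussianReal_eq_integral_smul one_ne_zero,
    integral_gaussianReal_eq_integral_smul one_ne_zero]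
  simp only [smul_eq_mul]
  rw [← sub_eq_zero, ← integral_sub j1 j2, ← neg_eq_zero, ← integral_neg]
  refine Eq.trans ?_ key
  congr 1
  ext x
  ring

instance (B : ℕ) : IsProbabilityMeasure (stdGauss B) := by
  unfold stdGauss
  infer_instance

theorem integrable_eval_stdGauss {B : ℕ} (i : Fin B) :
    Integrable (fun z : Fin B → ℝ => z i) (stdGauss B) :=
  (measurePreserving_eval (fun _ : Fin B => gaussianReal 0 1) i).integrable_comp_of_integrable
    ((memLp_id_gaussianReal (μ := 0) (v := 1) 1).integrable (by simp))

/-- Gaussian integration by parts in the coordinate `i` of a standard Gaussian vector. -/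
theorem integral_mul_stdGauss {n : ℕ} (i : Fin (n + 1)) {f f' : (Fin (n + 1) → ℝ) → ℝ} {C : ℝ}
    (hf : ∀ z, HasDerivAt (fun x => f (Function.update z i x)) (f' z) (z i))
    (hcont : Continuous f) (hcont' : Continuous f')
    (hC : ∀ z, |f z| ≤ C) (hC' : ∀ z, |f' z| ≤ C) :
    ∫ z, z i * f z ∂stdGauss (n + 1) = ∫ z, f' z ∂stdGauss (n + 1) := by
  have hmp := (measurePreserving_piFinSuccAbove (fun _ : Fin (n + 1) => gaussianReal 0 1) i).symm
  have hsymm : ∀ p : ℝ × (Fin n → ℝ),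
      (MeasurableEquiv.piFinSuccAbove (fun _ => ℝ) i).symm p = i.insertNth p.1 p.2 := fun _ => rfl
  have i1 : Integrable (fun z => z i * f z) (stdGauss (n + 1)) :=
    (integrable_eval_stdGauss i).mul_bdd (c := C) hcont.aestronglyMeasurable (ae_of_all _ hC)
  have i2 : Integrable f' (stdGauss (n + 1)) :=
    Integrable.of_bound hcont'.aestronglyMeasurable C (ae_of_all _ hC')
  have k1 := hmp.integrable_comp_of_integrable i1
  have k2 := hmp.integrable_comp_of_integrable i2
  rw [stdGauss, ← hmp.integral_comp', ← hmp.integral_comp',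
    integral_prod_symm _ (by exact k1), integral_prod_symm _ (by exact k2)]
  congr 1
  ext y
  simp only [hsymm, Fin.insertNth_apply_same]
  refine integral_mul_gaussianReal (C := C) (fun x => ?_) ?_ (fun x => hC _) (fun x => hC' _)
  · simpa using! hf (i.insertNth x y)
  · have : Continuous fun x : ℝ => (MeasurableEquiv.piFinSuccAbove (fun _ => ℝ) i).symm (x, y) := by
      refine continuous_pi (i.forall_iff_succAbove.2 ⟨?_, fun k => ?_⟩)
      · simpa only [hsymm, Fin.insertNth_apply_same] using continuous_id'
      · simpa only [hsymm, Fin.insertNth_apply_succAbove] using continuous_const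
    exact hcont'.comp this

/-- The Gibbs (softmax) weights of a finite family of exponents. -/
def gibbsWeight {ι : Type*} [Fintype ι] (a : ι → ℝ) (i : ι) : ℝ :=
  Real.exp (a i) / ∑ k, Real.exp (a k)

section Gibbs

variable {ι : Type*} [Fintype ι]

theorem sum_exp_pos [Nonempty ι] (a : ι → ℝ) : 0 < ∑ k, Real.exp (a k) :=
  Finset.sum_pos (fun _ _ => Real.exp_pos _) Finset.univ_nonempty

theorem gibbsWeight_nonneg [Nonempty ι] (a : ι → ℝ) (i : ι) : 0 ≤ gibbsWeight a i :=
  div_nonneg (Real.exp_pos _).le (sum_exp_pos a).le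

theorem sum_gibbsWeight [Nonempty ι] (a : ι → ℝ) : ∑ i, gibbsWeight a i = 1 := by
  simp only [gibbsWeight]
  rw [← Finset.sum_div, div_self (sum_exp_pos a).ne']

theorem gibbsWeight_le_one [Nonempty ι] (a : ι → ℝ) (i : ι) : gibbsWeight a i ≤ 1 := by
  rw [← sum_gibbsWeight a]
  exact Finset.single_le_sum (fun k _ => gibbsWeight_nonneg a k) (Finset.mem_univ i)

theorem Continuous.gibbsWeight [Nonempty ι] {X : Type*} [TopologicalSpace X] {a : X → ι → ℝ}
    (ha : Continuous a) (i : ι) : Continuous fun x => gibbsWeight (a x) i := by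
  unfold _root_.gibbsWeight
  exact Continuous.div (by fun_prop) (by fun_prop) fun x => (sum_exp_pos (a x)).ne'

theorem Continuous.log_sum_exp [Nonempty ι] {X : Type*} [TopologicalSpace X] {a : X → ι → ℝ}
    (ha : Continuous a) : Continuous fun x => Real.log (∑ k, Real.exp (a x k)) :=
  Continuous.log (by fun_prop) fun x => (sum_exp_pos (a x)).ne'

theorem hasDerivAt_sum_exp {a : ℝ → ι → ℝ} {a' : ι → ℝ} {t : ℝ}
    (h : ∀ i, HasDerivAt (fun s => a s i) (a' i) t) :
    HasDerivAt (fun s => ∑ k, Real.exp (a s k)) (∑ k, Real.exp (a t k) * a' k) t :=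
  HasDerivAt.fun_sum fun k _ => (h k).exp

theorem sum_gibbsWeight_mul (a b : ι → ℝ) :
    ∑ k, gibbsWeight a k * b k = (∑ k, Real.exp (a k) * b k) / ∑ k, Real.exp (a k) := by
  rw [Finset.sum_div]
  exact Finset.sum_congr rfl fun k _ => by rw [gibbsWeight]; ring

theorem hasDerivAt_log_sum_exp [Nonempty ι] {a : ℝ → ι → ℝ} {a' : ι → ℝ} {t : ℝ}
    (h : ∀ i, HasDerivAt (fun s => a s i) (a' i) t) :
    HasDerivAt (fun s => Real.log (∑ k, Real.exp (a s k)))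
      (∑ k, gibbsWeight (a t) k * a' k) t := by
  rw [sum_gibbsWeight_mul]
  exact (hasDerivAt_sum_exp h).log (sum_exp_pos _).ne'

theorem hasDerivAt_gibbsWeight [Nonempty ι] {a : ℝ → ι → ℝ} {a' : ι → ℝ} {t : ℝ}
    (h : ∀ i, HasDerivAt (fun s => a s i) (a' i) t) (i : ι) :
    HasDerivAt (fun s => gibbsWeight (a s) i)
      (gibbsWeight (a t) i * (a' i - ∑ k, gibbsWeight (a t) k * a' k)) t := by
  have hpos := (sum_exp_pos (a t)).ne'
  refine ((h i).exp.div (hasDerivAt_sum_exp h) hpos).congr_deriv ?_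
  rw [sum_gibbsWeight_mul, gibbsWeight]
  field_simp

theorem one_add_sum_erase_exp_sub [DecidableEq ι] (a : ι → ℝ) (i : ι) :
    1 + ∑ k ∈ Finset.univ.erase i, Real.exp (a k - a i) =
      (∑ k, Real.exp (a k)) / Real.exp (a i) := by
  rw [← Finset.add_sum_erase _ _ (Finset.mem_univ i), add_div, div_self (Real.exp_pos _).ne',
    Finset.sum_div]
  simp only [Real.exp_sub]

theorem abs_log_sum_exp_le [Nonempty ι] (a : ι → ℝ) :
    |Real.log (∑ k, Real.exp (a k))| ≤ Real.log (Fintype.card ι) + ∑ k, |a k| := by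
  have hle : ∀ k, |a k| ≤ ∑ k, |a k| := fun k =>
    Finset.single_le_sum (f := fun k => |a k|) (fun _ _ => abs_nonneg _) (Finset.mem_univ k)
  have hcard : (1 : ℝ) ≤ Fintype.card ι := by exact_mod_cast Fintype.card_pos (α := ι)
  rw [abs_le]
  constructor
  · obtain ⟨j⟩ := ‹Nonempty ι›
    have h1 : a j ≤ Real.log (∑ k, Real.exp (a k)) := by
      rw [Real.le_log_iff_exp_le (sum_exp_pos a)]
      exact Finset.single_le_sum (f := fun k => Real.exp (a k))
        (fun _ _ => (Real.exp_pos _).le) (Finset.mem_univ j)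
    linarith [hle j, neg_abs_le (a j), Real.log_nonneg hcard]
  · rw [Real.log_le_iff_le_exp (sum_exp_pos a), Real.exp_add, Real.exp_log (by linarith)]
    calc ∑ k, Real.exp (a k) ≤ ∑ _k : ι, Real.exp (∑ k, |a k|) :=
          Finset.sum_le_sum fun k _ => Real.exp_le_exp.2 ((le_abs_self _).trans (hle k))
      _ = _ := by simp

end Gibbs

/-- Unnormalized log-posterior of the section `k` when the section `j` is sent over the Gaussian
channel with signal amplitude `t` and noise `z`. -/
def logPosterior {B : ℕ} (j : Fin B) (t : ℝ) (z : Fin B → ℝ) (k : Fin B) : ℝ :=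
  t * z k + t ^ 2 * basisVec B j k

/-- Mean squared error of the posterior mean when the section `j` is sent. -/
def sectionMse {B : ℕ} (j : Fin B) (t : ℝ) : ℝ :=
  ∫ z, (∑ i, (gibbsWeight (logPosterior j t z) i - basisVec B j i) ^ 2) ∂stdGauss B

/-- Mean of minus the logarithm of the posterior probability of the section `j` sent. -/
def sectionEntropy {B : ℕ} (j : Fin B) (t : ℝ) : ℝ :=
  ∫ z, (Real.log (∑ k, Real.exp (logPosterior j t z k)) - logPosterior j t z j) ∂stdGauss B

theorem continuous_logPosterior {B : ℕ} (j : Fin B) (t : ℝ) : Continuous (logPosterior j t) := by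
  unfold logPosterior
  fun_prop

theorem sectionMse_comp_perm {B : ℕ} (σ : Equiv.Perm (Fin B)) (j : Fin B) (t : ℝ) :
    sectionMse (σ j) t = sectionMse j t := by
  have hmp := measurePreserving_piCongrLeft (fun _ : Fin B => gaussianReal 0 1) σ
  have happ : ∀ (z : Fin B → ℝ) (k : Fin B),
      MeasurableEquiv.piCongrLeft (fun _ => ℝ) σ z (σ k) = z k := fun z k =>
    MeasurableEquiv.piCongrLeft_apply_apply (β := fun _ => ℝ) σ z k
  have hbasis : ∀ k, basisVec B (σ j) (σ k) = basisVec B j k := fun k => by simp [basisVec]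
  have hlog : ∀ z k, logPosterior (σ j) t (MeasurableEquiv.piCongrLeft (fun _ => ℝ) σ z) (σ k) =
      logPosterior j t z k := fun z k => by rw [logPosterior, logPosterior, happ, hbasis]
  unfold sectionMse
  rw [stdGauss, ← hmp.integral_comp']
  congr 1
  ext z
  rw [← Equiv.sum_comp σ]
  refine Finset.sum_congr rfl fun i _ => ?_
  rw [hbasis, gibbsWeight, gibbsWeight, ← Equiv.sum_comp σ]
  simp only [hlog]

theorem sum_basisVec_mul {B : ℕ} (j : Fin B) (f : Fin B → ℝ) :
    ∑ i, f i * basisVec B j i = f j := by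
  simp [basisVec]

theorem integral_mul_gibbsWeight {n : ℕ} (j i : Fin (n + 1)) (t : ℝ) :
    ∫ z, z i * gibbsWeight (logPosterior j t z) i ∂stdGauss (n + 1) =
      ∫ z, t * (gibbsWeight (logPosterior j t z) i - gibbsWeight (logPosterior j t z) i ^ 2)
        ∂stdGauss (n + 1) := by
  have hc := (continuous_logPosterior j t).gibbsWeight i
  refine integral_mul_stdGauss (C := 1 + |t|) i (fun z => ?_) hc (by fun_prop) (fun z => ?_)
    (fun z => ?_)
  · have ha : ∀ k, HasDerivAt (fun x => logPosterior j t (Function.update z i x) k)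
        (if k = i then t else 0) (z i) := fun k => by
      unfold logPosterior
      by_cases hk : k = i
      · subst hk
        simpa using ((hasDerivAt_id (z k)).const_mul t).add_const (t ^ 2 * basisVec (n + 1) j k)
      · simpa only [Function.update_of_ne hk, if_neg hk] using
          hasDerivAt_const (z i) (t * z k + t ^ 2 * basisVec (n + 1) j k)
    refine (hasDerivAt_gibbsWeight ha i).congr_deriv ?_
    simp only [Function.update_eq_self, if_true, mul_ite, mul_zero, Finset.sum_ite_eq',
      Finset.mem_univ]
    ring
  · have h0 := gibbsWeight_nonneg (logPosterior j t z) i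
    have h1 := gibbsWeight_le_one (logPosterior j t z) i
    rw [abs_of_nonneg h0]
    linarith [abs_nonneg t]
  · have h0 := gibbsWeight_nonneg (logPosterior j t z) i
    have h1 := gibbsWeight_le_one (logPosterior j t z) i
    have : |gibbsWeight (logPosterior j t z) i - gibbsWeight (logPosterior j t z) i ^ 2| ≤ 1 := by
      rw [abs_le]; constructor <;> nlinarith
    rw [abs_mul]
    nlinarith [abs_nonneg t]

theorem integral_eval_stdGauss {n : ℕ} (i : Fin (n + 1)) : ∫ z, z i ∂stdGauss (n + 1) = 0 := by
  have := integral_mul_stdGauss (C := 1) i (f := fun _ => 1) (f' := fun _ => 0)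
    (fun z => hasDerivAt_const _ _) continuous_const continuous_const (by simp) (by simp)
  simpa using this

/-- The I-MMSE relation for the `B`-ary section channel. -/
theorem hasDerivAt_sectionEntropy {n : ℕ} (j : Fin (n + 1)) (t : ℝ) :
    HasDerivAt (sectionEntropy j) (-(t * sectionMse j t)) t := by
  set μ := stdGauss (n + 1) with hμ
  set p : ℝ → (Fin (n + 1) → ℝ) → Fin (n + 1) → ℝ := fun s z => gibbsWeight (logPosterior j s z)
    with hp
  have hp0 : ∀ s z i, 0 ≤ p s z i := fun s z i => gibbsWeight_nonneg _ _
  have hp1 : ∀ s z i, p s z i ≤ 1 := fun s z i => gibbsWeight_le_one _ _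
  have hpc : ∀ s i, Continuous fun z => p s z i := fun s i =>
    (continuous_logPosterior j s).gibbsWeight i
  have hpi : ∀ s i, Integrable (fun z => p s z i) μ := fun s i =>
    Integrable.of_bound (hpc s i).aestronglyMeasurable 1
      (ae_of_all _ fun z => by rw [Real.norm_eq_abs, abs_of_nonneg (hp0 s z i)]; exact hp1 s z i)
  have hzi : ∀ i, Integrable (fun z : Fin (n + 1) → ℝ => z i) μ := integrable_eval_stdGauss
  have hzp : ∀ i, Integrable (fun z => z i * p t z i) μ := fun i =>
    (hzi i).mul_bdd (c := 1) (hpc t i).aestronglyMeasurable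
      (ae_of_all _ fun z => by rw [Real.norm_eq_abs, abs_of_nonneg (hp0 t z i)]; exact hp1 t z i)
  have hb : ∀ k, |basisVec (n + 1) j k| ≤ 1 := fun k => by
    unfold basisVec; split_ifs <;> simp
  have hder : ∀ s z k, HasDerivAt (fun s => logPosterior j s z k)
      (z k + 2 * s * basisVec (n + 1) j k) s := fun s z k => by
    have := ((hasDerivAt_id s).mul_const (z k)).add
      (((hasDerivAt_id s).pow 2).mul_const (basisVec (n + 1) j k))
    exact this.congr_deriv (by simp)
  have hint : Integrable (fun z => Real.log (∑ k, Real.exp (logPosterior j t z k)) -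
      logPosterior j t z j) μ := by
    have hl : ∀ k, Integrable (fun z => logPosterior j t z k) μ := fun k =>
      ((hzi k).const_mul t).add (integrable_const _)
    refine Integrable.sub ?_ (hl j)
    refine Integrable.mono' (g := fun z => Real.log (Fintype.card (Fin (n + 1))) +
      ∑ k, |logPosterior j t z k|) ((integrable_const _).add
        (integrable_finsetSum _ fun k _ => (hl k).abs))
      (continuous_logPosterior j t).log_sum_exp.aestronglyMeasurable
      (ae_of_all _ fun z => abs_log_sum_exp_le _)
  have hcoord : ∀ s ∈ Metric.ball t 1, ∀ (z : Fin (n + 1) → ℝ) k,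
      |z k + 2 * s * basisVec (n + 1) j k| ≤ |z k| + 2 * (|t| + 1) := fun s hs z k => by
    have hs' : |s| ≤ |t| + 1 := by
      rw [Metric.mem_ball, Real.dist_eq] at hs
      have := abs_sub_abs_le_abs_sub s t
      linarith
    refine (abs_add_le _ _).trans (add_le_add_right ?_ _)
    rw [abs_mul, abs_mul, abs_two]
    have := hb k
    nlinarith [abs_nonneg s, abs_nonneg t, abs_nonneg (basisVec (n + 1) j k)]
  have main := (hasDerivAt_integral_of_dominated_loc_of_deriv_le (μ := μ) (x₀ := t)
    (F := fun s z => Real.log (∑ k, Real.exp (logPosterior j s z k)) - logPosterior j s z j)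
    (F' := fun s z => (∑ k, p s z k * (z k + 2 * s * basisVec (n + 1) j k)) -
      (z j + 2 * s * basisVec (n + 1) j j))
    (bound := fun z => (∑ k, (|z k| + 2 * (|t| + 1))) + (|z j| + 2 * (|t| + 1)))
    (Metric.ball_mem_nhds t one_pos)
    (Eventually.of_forall fun s => ((continuous_logPosterior j s).log_sum_exp.sub
      ((continuous_apply j).comp (continuous_logPosterior j s))).aestronglyMeasurable)
    hint
    (Continuous.aestronglyMeasurable (by have := hpc t; fun_prop))
    (ae_of_all _ fun z s hs => by
      rw [Real.norm_eq_abs]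
      refine (abs_sub _ _).trans (add_le_add ?_ (hcoord s hs z j))
      refine (Finset.abs_sum_le_sum_abs _ _).trans (Finset.sum_le_sum fun k _ => ?_)
      rw [abs_mul, abs_of_nonneg (hp0 s z k)]
      exact (mul_le_of_le_one_left (abs_nonneg _) (hp1 s z k)).trans (hcoord s hs z k))
    ((integrable_finsetSum _ fun k _ => (hzi k).abs.add (integrable_const _)).add
      ((hzi j).abs.add (integrable_const _)))
    (ae_of_all _ fun z s _ => (hasDerivAt_log_sum_exp (hder s z)).sub (hder s z j))).2
  refine main.congr_deriv ?_
  have hsplit : ∀ z : Fin (n + 1) → ℝ, (∑ k, p t z k * (z k + 2 * t * basisVec (n + 1) j k)) -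
      (z j + 2 * t * basisVec (n + 1) j j) =
      ((∑ k, z k * p t z k) + (2 * t * p t z j - 2 * t)) - z j := fun z => by
    have h1 : ∑ k, p t z k * (z k + 2 * t * basisVec (n + 1) j k) =
        ∑ k, z k * p t z k + 2 * t * ∑ k, p t z k * basisVec (n + 1) j k := by
      rw [Finset.mul_sum, ← Finset.sum_add_distrib]
      exact Finset.sum_congr rfl fun k _ => by ring
    rw [h1, sum_basisVec_mul]
    simp only [basisVec, if_true]
    ring
  have hpp : ∀ i, Integrable (fun z => t * (p t z i - p t z i ^ 2)) μ := fun i => by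
    refine ((hpi t i).sub (Integrable.of_bound (((hpc t i).pow 2).aestronglyMeasurable) 1
      (ae_of_all _ fun z => ?_))).const_mul t
    rw [Real.norm_eq_abs, abs_of_nonneg (sq_nonneg _)]
    exact pow_le_one₀ (hp0 t z i) (hp1 t z i)
  have i1 : Integrable (fun z => 2 * t * p t z j - 2 * t) μ :=
    ((hpi t j).const_mul _).sub (integrable_const _)
  simp only [hsplit]
  have hsum : Integrable (fun z => ∑ k, z k * p t z k) μ :=
    integrable_finsetSum _ fun k _ => hzp k
  rw [integral_sub (by exact hsum.add i1) (hzi j), integral_add hsum i1,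
    integral_finsetSum _ (fun k _ => hzp k), hμ, integral_eval_stdGauss, sub_zero]
  simp only [hp, integral_mul_gibbsWeight]
  rw [← integral_finsetSum _ (fun k _ => hpp k), ← integral_add
    (integrable_finsetSum _ fun k _ => hpp k) i1, sectionMse, ← integral_const_mul, ← integral_neg]
  congr 1
  ext z
  have h1 : ∑ i, (p t z i - basisVec (n + 1) j i) ^ 2 =
      ∑ i, p t z i ^ 2 - 2 * ∑ i, p t z i * basisVec (n + 1) j i +
        ∑ i, basisVec (n + 1) j i * basisVec (n + 1) j i := by
    rw [Finset.mul_sum, ← Finset.sum_sub_distrib, ← Finset.sum_add_distrib]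
    exact Finset.sum_congr rfl fun k _ => by ring
  have h2 : ∑ i, p t z i = 1 := sum_gibbsWeight _
  have h3 : basisVec (n + 1) j j = 1 := by simp [basisVec]
  rw [sum_basisVec_mul, sum_basisVec_mul, h3] at h1
  rw [← Finset.mul_sum, Finset.sum_sub_distrib, h1, h2]
  ring

theorem exponent_eq_logPosterior_sub {B : ℕ} (j i k : Fin B) (Sn : ℝ) (z : Fin B → ℝ) :
    (basisVec B j k - basisVec B j i) * Real.logb 2 B / Sn ^ 2 +
        (z k - z i) * Real.sqrt (Real.logb 2 B) / Sn =
      logPosterior j (Real.sqrt (Real.logb 2 B) / Sn) z k -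
        logPosterior j (Real.sqrt (Real.logb 2 B) / Sn) z i := by
  have hL : 0 ≤ Real.logb 2 B := Real.logb_nonneg one_lt_two (by exact_mod_cast i.pos)
  unfold logPosterior
  rw [div_pow, Real.sq_sqrt hL]
  ring

theorem mmseB_eq_sectionMse {n : ℕ} (Sn : ℝ) :
    mmseB (n + 1) Sn =
      sectionMse (0 : Fin (n + 1)) (Real.sqrt (Real.logb 2 ((n + 1 : ℕ) : ℝ)) / Sn) := by
  have h : ∀ j : Fin (n + 1), (∫ z, (∑ i, (denoiser (n + 1) Sn (basisVec (n + 1) j) z i -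
      basisVec (n + 1) j i) ^ 2) ∂stdGauss (n + 1)) =
      sectionMse (0 : Fin (n + 1)) (Real.sqrt (Real.logb 2 ((n + 1 : ℕ) : ℝ)) / Sn) := fun j => by
    rw [← sectionMse_comp_perm (Equiv.swap 0 j) 0, Equiv.swap_apply_left, sectionMse]
    simp only [denoiser, exponent_eq_logPosterior_sub, one_add_sum_erase_exp_sub, inv_div,
      gibbsWeight]
  rw [mmseB]
  simp only [h, Finset.sum_const, Finset.card_univ, Fintype.card_fin, nsmul_eq_mul]
  rw [← mul_assoc, inv_mul_cancel₀ (by positivity), one_mul]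

theorem Su_eq_sectionEntropy {n : ℕ} (Sn : ℝ) :
    Su (n + 1) Sn =
      sectionEntropy (0 : Fin (n + 1)) (Real.sqrt (Real.logb 2 ((n + 1 : ℕ) : ℝ)) / Sn) /
        Real.log ((n + 1 : ℕ) : ℝ) := by
  rw [Su, dif_pos n.succ_pos, sectionEntropy, ← integral_div]
  congr 1
  ext z
  have h : ∀ k ∈ Finset.univ.erase (0 : Fin (n + 1)),
      Real.exp ((z k - z 0) * Real.sqrt (Real.logb 2 ((n + 1 : ℕ) : ℝ)) / Sn -
        Real.logb 2 ((n + 1 : ℕ) : ℝ) / Sn ^ 2) =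
      Real.exp (logPosterior 0 (Real.sqrt (Real.logb 2 ((n + 1 : ℕ) : ℝ)) / Sn) z k -
        logPosterior 0 (Real.sqrt (Real.logb 2 ((n + 1 : ℕ) : ℝ)) / Sn) z 0) := fun k hk => by
    have hk : k ≠ 0 := (Finset.mem_erase.1 hk).1
    rw [← exponent_eq_logPosterior_sub]
    simp only [basisVec, if_neg hk, if_true]
    congr 1
    ring
  have h2 := one_add_sum_erase_exp_sub
    (logPosterior 0 (Real.sqrt (Real.logb 2 ((n + 1 : ℕ) : ℝ)) / Sn) z) 0
  rw [← Finset.sum_congr rfl h] at h2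
  rw [Real.logb, h2, Real.log_div (sum_exp_pos _).ne' (Real.exp_pos _).ne', Real.log_exp]

/-- Derivative of the entropy term with respect to the inverse noise variance. -/
theorem hasDerivAt_Su_inv_sqrt {B : ℕ} (hB : 2 ≤ B) {V : ℝ → ℝ} {V' x : ℝ}
    (hV : HasDerivAt V V' x) (hpos : 0 < V x) :
    HasDerivAt (fun y => Su B (Real.sqrt (V y))⁻¹)
      (-(V' * mmseB B (Real.sqrt (V x))⁻¹ / (2 * Real.log 2))) x := by
  obtain ⟨n, rfl⟩ : ∃ n, B = n + 1 := ⟨B - 1, by omega⟩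
  have hlog : 0 < Real.log ((n + 1 : ℕ) : ℝ) := Real.log_pos (by exact_mod_cast hB)
  have hlog2 : 0 < Real.log 2 := Real.log_pos one_lt_two
  simp only [Su_eq_sectionEntropy, mmseB_eq_sectionMse, div_inv_eq_mul]
  set L := Real.logb 2 ((n + 1 : ℕ) : ℝ) with hL
  have hLpos : 0 ≤ L := div_nonneg hlog.le hlog2.le
  have h1 : HasDerivAt (fun y => √L * √(V y)) (√L * (V' / (2 * √(V x)))) x :=
    (hV.sqrt hpos.ne').const_mul _
  have h2 := ((hasDerivAt_sectionEntropy (0 : Fin (n + 1)) (√L * √(V x))).comp x h1).div_const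
    (Real.log ((n + 1 : ℕ) : ℝ))
  refine h2.congr_deriv ?_
  have hLe : Real.log ((n + 1 : ℕ) : ℝ) = L * Real.log 2 := by
    rw [hL, Real.logb, div_mul_cancel₀ _ hlog2.ne']
  have hVs : 0 < √(V x) := Real.sqrt_pos.2 hpos
  generalize sectionMse (0 : Fin (n + 1)) (√L * √(V x)) = m
  rw [hLe] at hlog ⊢
  have hL0 : L ≠ 0 := fun h => by simp [h] at hlog
  field_simp
  rw [Real.sq_sqrt hLpos]
  ring

theorem hasDerivAt_Uu {R σ2 x : ℝ} (hx : 0 < σ2 + x) :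
    HasDerivAt (Uu R σ2) (x / (2 * Real.log 2 * R * (σ2 + x) ^ 2)) x := by
  have h0 : HasDerivAt (fun y => σ2 + y) 1 x := (hasDerivAt_id x).const_add σ2
  have h1 : HasDerivAt (fun y => y / (σ2 + y)) ((1 * (σ2 + x) - x * 1) / (σ2 + x) ^ 2) x :=
    (hasDerivAt_id x).div h0 hx.ne'
  have h2 := (((h0.mul h1.neg.exp).log (mul_pos hx (Real.exp_pos _)).ne').div_const
    (Real.log 2)).const_mul (1 / (2 * R))
  refine h2.congr_deriv ?_
  have hlog2 : Real.log 2 ≠ 0 := (Real.log_pos one_lt_two).ne'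
  have he := (Real.exp_pos (-(x / (σ2 + x)))).ne'
  simp only [Pi.mul_apply, Pi.neg_apply]
  rcases eq_or_ne R 0 with rfl | hR
  · simp
  field_simp
  ring

/-- The gradient of the coupled potential is proportional to the residual of the coupled
state evolution. -/
theorem hasDerivAt_Fc_update {B : ℕ} (hB : 2 ≤ B) {R σ2 : ℝ} (hR : 0 < R)
    {Γ : ℕ} {J : Fin Γ → Fin Γ → ℝ} (hJ : ∀ r c, 0 ≤ J r c) (hJd : ∀ r, 0 < J r r)
    {E : Fin Γ → ℝ} (hE : ∀ r, 0 < σ2 + E r) (r : Fin Γ) :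
    HasDerivAt (fun x => Fc B R σ2 Γ J (Function.update E r x))
      ((E r - Tc B R σ2 Γ J E r) / (2 * Real.log 2 * R * (σ2 + E r) ^ 2)) (E r) := by
  have hΓ : (0 : ℝ) < Γ := by exact_mod_cast r.pos
  have hupd : ∀ i, HasDerivAt (fun x => Function.update E r x i) (if i = r then 1 else 0) (E r) :=
    fun i => by
      by_cases hi : i = r
      · subst hi
        simpa using hasDerivAt_id' (E i)
      · simpa only [Function.update_of_ne hi, if_neg hi] using hasDerivAt_const (E r) (E i)
  have hU : HasDerivAt (fun x => ∑ i, Uu R σ2 (Function.update E r x i))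
      (E r / (2 * Real.log 2 * R * (σ2 + E r) ^ 2)) (E r) := by
    have h := HasDerivAt.fun_sum (u := Finset.univ) fun i _ => HasDerivAt.comp (E r)
      (h₂ := Uu R σ2) (by rw [Function.update_eq_self]; exact hasDerivAt_Uu (hE i)) (hupd i)
    refine h.congr_deriv ?_
    simp
  have hV : ∀ c, HasDerivAt
      (fun x => (Γ : ℝ)⁻¹ * ∑ i, J i c / (R * (σ2 + Function.update E r x i)))
      (-((Γ : ℝ)⁻¹ * (J r c / (R * (σ2 + E r) ^ 2)))) (E r) := fun c => by
    have h := (HasDerivAt.fun_sum (u := Finset.univ) fun i _ =>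
      ((hasDerivAt_const (E r) (J i c)).div (((hupd i).const_add σ2).const_mul R)
        (by rw [Function.update_eq_self]; exact (mul_pos hR (hE i)).ne'))).const_mul (Γ : ℝ)⁻¹
    refine h.congr_deriv ?_
    have hr := (hE r).ne'
    rw [Finset.sum_eq_single r (fun i _ hi => by simp [hi]) (by simp), Function.update_eq_self]
    simp only [if_true]
    field_simp
    ring
  have hVpos : ∀ c, 0 < (Γ : ℝ)⁻¹ * ∑ i, J i c / (R * (σ2 + Function.update E r (E r) i)) :=
    fun c => by
      rw [Function.update_eq_self]
      exact mul_pos (inv_pos.2 hΓ) (Finset.sum_pos'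
        (fun i _ => div_nonneg (hJ i c) (mul_pos hR (hE i)).le)
        ⟨c, Finset.mem_univ c, div_pos (hJd c) (mul_pos hR (hE c))⟩)
  refine (hU.sub (HasDerivAt.fun_sum (u := Finset.univ) fun c _ =>
    hasDerivAt_Su_inv_sqrt hB (hV c) (hVpos c))).congr_deriv ?_
  rw [Function.update_eq_self, Tc, sub_div, Finset.mul_sum, Finset.sum_div]
  congr 1
  refine Finset.sum_congr rfl fun c _ => ?_
  rw [sigC]
  have hr := (hE r).ne'
  have hlog2 : Real.log 2 ≠ 0 := (Real.log_pos one_lt_two).ne'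
  field_simp

/-- a fixed point of the coupled state evolution is a stationary point
of the coupled potential in the bulk `{3w+1, …, Γ-3w}` (0-based: `3w ≤ r < Γ-3w`). -/
theorem stationarity_of_coupled_fixed_points
    (B : ℕ) (hB : 2 ≤ B) (R σ2 : ℝ) (hR : 0 < R) (hσ2 : 0 < σ2)
    (Γ w : ℕ) (hw : 0 < w) (hΓ : 8 * w < Γ)
    (g : ℝ → ℝ) (g0 gs : ℝ) (hg0 : 0 < g0) (hgs : 0 ≤ gs)
    (hsupp : ∀ x : ℝ, 1 < |x| → g x = 0)
    (hlow : ∀ x : ℝ, |x| ≤ 1 → g0 ≤ g x)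
    (hlip : ∀ x ∈ Set.Icc (-1:ℝ) 1, ∀ y ∈ Set.Icc (-1:ℝ) 1, |g x - g y| ≤ gs * |x - y|)
    (hgnorm : (2*(w:ℝ)+1)⁻¹ * ∑ k ∈ Finset.Icc (-(w:ℤ)) (w:ℤ), g ((k:ℝ)/(w:ℝ)) = 1)
    (γv : Fin Γ → ℝ) (hγ : ∀ r, 0 < γv r)
    (J : Fin Γ → Fin Γ → ℝ)
    (hJ : ∀ r c : Fin Γ, J r c = γv r * (Γ:ℝ) * g (((r.1:ℝ) - (c.1:ℝ))/(w:ℝ)) / (2*(w:ℝ)+1))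
    (hrow : ∀ r : Fin Γ, (Γ:ℝ)⁻¹ * ∑ c, J r c = 1)
    (E : Fin Γ → ℝ) (hbox : ∀ r, E r ∈ Set.Icc (0:ℝ) 1)
    (hpin : ∀ r : Fin Γ, (r.1 < 3*w ∨ Γ - 3*w ≤ r.1) → E r = 0)
    (hfix : ∀ r : Fin Γ, ¬(r.1 < 3*w ∨ Γ - 3*w ≤ r.1) → Tc B R σ2 Γ J E r = E r) :
    ∀ r : Fin Γ, 3*w ≤ r.1 → r.1 < Γ - 3*w →
      pderiv Γ (Fc B R σ2 Γ J) r E = 0 := by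
  intro r hr1 hr2
  have hw' : (0 : ℝ) < w := by exact_mod_cast hw
  have hg : ∀ x, 0 ≤ g x := fun x => by
    rcases le_or_gt |x| 1 with h | h
    · exact hg0.le.trans (hlow x h)
    · exact (hsupp x h).ge
  have hJ0 : ∀ r c, 0 ≤ J r c := fun r c => by
    have := hγ r
    have := hg (((r.1:ℝ) - (c.1:ℝ))/(w:ℝ))
    rw [hJ]
    positivity
  have hJd : ∀ r, 0 < J r r := fun r => by
    have := hγ r
    have hΓ' : (0 : ℝ) < Γ := by exact_mod_cast r.pos
    have : 0 < g 0 := hg0.trans_le (hlow 0 (by simp))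
    rw [hJ, sub_self, zero_div]
    positivity
  have hder := hasDerivAt_Fc_update hB hR hJ0 hJd
    (fun i => add_pos_of_pos_of_nonneg hσ2 (hbox i).1) r
  rw [pderiv, hder.deriv, hfix r (by omega), sub_self, zero_div]
end
end

section
/- The underlying state evolution operator is monotone: if 0 ≤ E ≤ G then T_u(E) ≤ T_u(G). Equivalently, the minimum mean square error E_{s,z}[Σ_{i=1}^B (f_i(Σ) − s_i)²] of the effective B-dimensional Gaussian channel is a nondecreasing function of the effective noise level Σ > 0. -/
open MeasureTheory ProbabilityTheory Filter Finset Real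

noncomputable section

instance isProbabilityMeasure_stdGauss (B : ℕ) : IsProbabilityMeasure (stdGauss B) := by
  unfold stdGauss; infer_instance

/-- The softmax function with inverse temperature `a`. -/
def softmax {B : ℕ} (a : ℝ) (y : Fin B → ℝ) (i : Fin B) : ℝ :=
  Real.exp (a * y i) / ∑ k, Real.exp (a * y k)

lemma sum_exp_pos_s2 {B : ℕ} (i : Fin B) (x : Fin B → ℝ) : 0 < ∑ k, Real.exp (x k) :=
  Finset.sum_pos (fun _ _ => Real.exp_pos _) ⟨i, Finset.mem_univ i⟩

lemma softmax_nonneg {B : ℕ} (a : ℝ) (y : Fin B → ℝ) (i : Fin B) : 0 ≤ softmax a y i :=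
  div_nonneg (Real.exp_pos _).le (sum_exp_pos_s2 i _).le

lemma softmax_le_one {B : ℕ} (a : ℝ) (y : Fin B → ℝ) (i : Fin B) : softmax a y i ≤ 1 :=
  div_le_one_of_le₀ (Finset.single_le_sum (f := fun k => Real.exp (a * y k))
    (fun _ _ => (Real.exp_pos _).le) (Finset.mem_univ i)) (sum_exp_pos_s2 i _).le

lemma abs_softmax_le_one {B : ℕ} (a : ℝ) (y : Fin B → ℝ) (i : Fin B) : |softmax a y i| ≤ 1 := by
  rw [abs_of_nonneg (softmax_nonneg a y i)]
  exact softmax_le_one a y i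

@[fun_prop]
lemma measurable_softmax {B : ℕ} (a : ℝ) : Measurable (softmax (B := B) a) := by
  unfold softmax
  fun_prop

/-- The denoiser is the softmax of the channel output `a s + z` with `a = √(log₂ B) / Σ`. -/
lemma denoiser_eq_softmax {B : ℕ} (hB : 2 ≤ B) (Sn : ℝ) (s z : Fin B → ℝ) (i : Fin B) :
    denoiser B Sn s z i =
      softmax (√(Real.logb 2 B) / Sn) ((√(Real.logb 2 B) / Sn) • s + z) i := by
  have hL : 0 ≤ Real.logb 2 B :=
    Real.logb_nonneg one_lt_two (by exact_mod_cast (by lia : 1 ≤ B))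
  set a := √(Real.logb 2 B) / Sn with ha
  have ha2 : Real.logb 2 B / Sn ^ 2 = a ^ 2 := by rw [ha, div_pow, Real.sq_sqrt hL]
  have hexp (k : Fin B) : Real.exp ((s k - s i) * Real.logb 2 B / Sn ^ 2 +
      (z k - z i) * √(Real.logb 2 B) / Sn) =
      Real.exp (a * (a • s + z) k) / Real.exp (a * (a • s + z) i) := by
    rw [← Real.exp_sub, mul_div_assoc, mul_div_assoc, ha2, ← ha]
    congr 1
    simp only [Pi.add_apply, Pi.smul_apply, smul_eq_mul]
    ring
  unfold denoiser softmax
  simp_rw [hexp]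
  rw [← Finset.sum_div, ← Finset.add_sum_erase _ _ (Finset.mem_univ i)]
  have := Real.exp_pos (a * (a • s + z) i)
  have h2 : 0 ≤ ∑ k ∈ Finset.univ.erase i, Real.exp (a * (a • s + z) k) :=
    Finset.sum_nonneg fun _ _ => (Real.exp_pos _).le
  field_simp

/-- Squared error of the estimate `x` of the section `basisVec B j`. -/
def sqErr {B : ℕ} (j : Fin B) (x : Fin B → ℝ) : ℝ := ∑ i, (x i - basisVec B j i) ^ 2

@[fun_prop]
lemma measurable_sqErr {B : ℕ} (j : Fin B) : Measurable (sqErr j) := by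
  unfold sqErr
  fun_prop

lemma abs_sqErr_le {B : ℕ} (j : Fin B) {x : Fin B → ℝ} (hx : ∀ i, |x i| ≤ 1) :
    |sqErr j x| ≤ 4 * B := by
  rw [abs_of_nonneg (Finset.sum_nonneg fun _ _ => sq_nonneg _)]
  calc sqErr j x ≤ ∑ _i : Fin B, (4 : ℝ) := by
        refine Finset.sum_le_sum fun i _ => ?_
        have := abs_le.1 (hx i)
        unfold basisVec
        split_ifs <;> nlinarith
    _ = 4 * B := by simp [mul_comm]

/-- The weighted squared error is minimal at the posterior mean. -/
lemma sum_exp_mul_sqErr_softmax_le {B : ℕ} (b : ℝ) (y x : Fin B → ℝ) :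
    ∑ j, Real.exp (b * y j - b ^ 2 / 2) * sqErr j (softmax b y) ≤
      ∑ j, Real.exp (b * y j - b ^ 2 / 2) * sqErr j x := by
  have key (t : Fin B → ℝ) : ∑ j, Real.exp (b * y j - b ^ 2 / 2) * sqErr j t =
      Real.exp (-(b ^ 2 / 2)) * ∑ i, ((∑ j, Real.exp (b * y j)) * t i ^ 2
        - 2 * t i * Real.exp (b * y i) + Real.exp (b * y i)) := by
    simp_rw [sqErr, Finset.mul_sum]
    rw [Finset.sum_comm]
    refine Finset.sum_congr rfl fun i _ => ?_
    have h (j : Fin B) : Real.exp (b * y j - b ^ 2 / 2) * (t i - basisVec B j i) ^ 2 =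
        Real.exp (-(b ^ 2 / 2)) * (Real.exp (b * y j) * t i ^ 2) +
        if i = j then Real.exp (-(b ^ 2 / 2)) *
          (Real.exp (b * y j) * (1 - 2 * t i)) else 0 := by
      rw [sub_eq_add_neg, Real.exp_add, basisVec]
      split_ifs <;> ring
    simp_rw [h]
    rw [Finset.sum_add_distrib, Finset.sum_ite_eq, if_pos (Finset.mem_univ _), ← Finset.mul_sum,
      ← Finset.sum_mul]
    ring
  rw [key, key]
  gcongr ?_ * ?_
  refine Finset.sum_le_sum fun i _ => ?_
  have hW : 0 < ∑ j, Real.exp (b * y j) := sum_exp_pos_s2 i _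
  have hg : Real.exp (b * y i) = (∑ j, Real.exp (b * y j)) * softmax b y i := by
    unfold softmax
    field_simp
  rw [hg]
  nlinarith [mul_nonneg hW.le (sq_nonneg (x i - softmax b y i))]

lemma gaussianReal_eq_withDensity (b : ℝ) :
    gaussianReal b 1 =
      (gaussianReal 0 1).withDensity fun x => ENNReal.ofReal (Real.exp (b * x - b ^ 2 / 2)) := by
  rw [gaussianReal_of_var_ne_zero _ one_ne_zero, gaussianReal_of_var_ne_zero _ one_ne_zero,
    ← withDensity_mul _ (measurable_gaussianPDF _ _) (by fun_prop)]
  congr 1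
  ext x
  rw [Pi.mul_apply, gaussianPDF, gaussianPDF, ← ENNReal.ofReal_mul (gaussianPDFReal_nonneg _ _ _),
    gaussianPDFReal, gaussianPDFReal, mul_assoc (√_)⁻¹, ← Real.exp_add]
  congr 3
  simp only [NNReal.coe_one]
  ring

/-- Cameron–Martin formula along a coordinate direction. -/
lemma map_add_stdGauss {B : ℕ} (b : ℝ) (j : Fin B) :
    (stdGauss B).map (fun z => b • basisVec B j + z) =
      (stdGauss B).withDensity fun y => ENNReal.ofReal (Real.exp (b * y j - b ^ 2 / 2)) := by
  have hmap : (stdGauss B).map (fun z => b • basisVec B j + z) =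
      Measure.pi fun i => gaussianReal (b * basisVec B j i) 1 := by
    have := Measure.pi_map_pi (μ := fun _ : Fin B => gaussianReal 0 1)
      (f := fun i x => b * basisVec B j i + x) (fun i => by fun_prop)
    simp_rw [gaussianReal_map_const_add, zero_add] at this
    exact this
  rw [hmap]
  refine Measure.pi_eq fun s hs => ?_
  have hdens : Measurable fun x : ℝ => ENNReal.ofReal (Real.exp (b * x - b ^ 2 / 2)) := by fun_prop
  rw [withDensity_apply _ (MeasurableSet.univ_pi hs), stdGauss, Measure.restrict_pi_pi,
    ← lintegral_map (f := fun x => ENNReal.ofReal (Real.exp (b * x - b ^ 2 / 2))) hdens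
      (g := fun y : Fin B → ℝ => y j) (measurable_pi_apply j)]
  change ∫⁻ x, _ ∂(Measure.map (Function.eval j : (Fin B → ℝ) → ℝ) _) = _
  rw [Measure.pi_map_eval, lintegral_smul_measure, ← withDensity_apply _ (hs j),
    ← gaussianReal_eq_withDensity, ← Finset.prod_erase_mul _ _ (Finset.mem_univ j), smul_eq_mul]
  congr 1
  · refine Finset.prod_congr rfl fun i hi => ?_
    simp [basisVec, Finset.ne_of_mem_erase hi]
  · simp [basisVec]

lemma integral_add_stdGauss {B : ℕ} (b : ℝ) (j : Fin B) {φ : (Fin B → ℝ) → ℝ}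
    (hφ : Measurable φ) :
    ∫ z, φ (b • basisVec B j + z) ∂stdGauss B =
      ∫ y, Real.exp (b * y j - b ^ 2 / 2) * φ y ∂stdGauss B := by
  rw [← integral_map (φ := fun z => b • basisVec B j + z) (by fun_prop)
    hφ.aestronglyMeasurable, map_add_stdGauss,
    integral_withDensity_eq_integral_toReal_smul (by fun_prop) (by simp)]
  simp [ENNReal.toReal_ofReal (Real.exp_pos _).le]

lemma integrable_exp_mul_stdGauss {B : ℕ} (b : ℝ) (j : Fin B) {φ : (Fin B → ℝ) → ℝ}
    (hφ : Measurable φ) {C : ℝ} (hC : ∀ y, |φ y| ≤ C) :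
    Integrable (fun y => Real.exp (b * y j - b ^ 2 / 2) * φ y) (stdGauss B) := by
  have h1 : Integrable (fun x => Real.exp (b * x - b ^ 2 / 2)) (gaussianReal 0 1) := by
    simp_rw [Real.exp_sub]
    exact (integrable_exp_mul_gaussianReal b).div_const _
  have h2 : Integrable (fun y : Fin B → ℝ => Real.exp (b * y j - b ^ 2 / 2)) (stdGauss B) :=
    (measurePreserving_eval (fun _ : Fin B => gaussianReal 0 1) j).integrable_comp_of_integrable h1
  exact h2.mul_bdd hφ.aestronglyMeasurable (ae_of_all _ hC)

/-- The softmax is the minimum mean square error estimator at noise level `1 / b`. -/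
lemma sum_integral_sqErr_softmax_le {B : ℕ} (b : ℝ) {h : (Fin B → ℝ) → Fin B → ℝ}
    (hm : Measurable h) (hb : ∀ y i, |h y i| ≤ 1) :
    ∑ j, ∫ z, sqErr j (softmax b (b • basisVec B j + z)) ∂stdGauss B ≤
      ∑ j, ∫ z, sqErr j (h (b • basisVec B j + z)) ∂stdGauss B := by
  have key {g : (Fin B → ℝ) → Fin B → ℝ} (hm : Measurable g) (hb : ∀ y i, |g y i| ≤ 1)
      (j : Fin B) : Integrable
        (fun y => Real.exp (b * y j - b ^ 2 / 2) * sqErr j (g y)) (stdGauss B) :=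
    integrable_exp_mul_stdGauss b j (by fun_prop) fun y => abs_sqErr_le j (hb y)
  have hs := abs_softmax_le_one (B := B) b
  have e {g : (Fin B → ℝ) → Fin B → ℝ} (hm : Measurable g) (j : Fin B) :=
    integral_add_stdGauss b j (φ := fun y => sqErr j (g y)) (by fun_prop)
  rw [Finset.sum_congr rfl fun j _ => e (measurable_softmax b) j,
    Finset.sum_congr rfl fun j _ => e hm j,
    ← integral_finsetSum _ fun j _ => key (measurable_softmax b) hs j,
    ← integral_finsetSum _ fun j _ => key hm hb j]
  exact integral_mono (integrable_finsetSum _ fun j _ => key (measurable_softmax b) hs j)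
    (integrable_finsetSum _ fun j _ => key hm hb j)
    fun y => sum_exp_mul_sqErr_softmax_le b y (h y)

/-- The standard Gaussian measure is invariant under Gaussian noising. -/
lemma map_prod_stdGauss (B : ℕ) {c d : ℝ} (hcd : c ^ 2 + d ^ 2 = 1) :
    ((stdGauss B).prod (stdGauss B)).map (fun p => c • p.1 + d • p.2) = stdGauss B := by
  have h1 : ((gaussianReal 0 1).prod (gaussianReal 0 1)).map (fun p => c * p.1 + d * p.2) =
      gaussianReal 0 1 := by
    have : ((gaussianReal 0 1).prod (gaussianReal 0 1)).map (fun p => c * p.1 + d * p.2) =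
        ((gaussianReal 0 1).map (c * ·)) ∗ ((gaussianReal 0 1).map (d * ·)) := by
      rw [Measure.conv, Measure.map_prod_map _ _ (by fun_prop) (by fun_prop),
        Measure.map_map (by fun_prop) (by fun_prop)]
      rfl
    rw [this, gaussianReal_map_const_mul, gaussianReal_map_const_mul, gaussianReal_conv_gaussianReal]
    congr 1
    · simp
    · ext
      simpa using hcd
  have h2 := measurePreserving_arrowProdEquivProdArrow ℝ ℝ (Fin B)
    (fun _ => gaussianReal 0 1) (fun _ => gaussianReal 0 1)
  have h3 := Measure.pi_map_pi (μ := fun _ : Fin B => (gaussianReal 0 1).prod (gaussianReal 0 1))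
    (f := fun _ p => c * p.1 + d * p.2) (fun _ => by fun_prop)
  simp_rw [h1] at h3
  unfold stdGauss
  rw [← h2.map_eq, Measure.map_map (by fun_prop) h2.measurable]
  exact h3

/-- The minimum mean square error is nonincreasing in the signal amplitude. -/
lemma sum_integral_sqErr_softmax_anti {B : ℕ} {a b : ℝ} (ha : 0 ≤ a) (hb : 0 < b) (hab : a ≤ b) :
    ∑ j, ∫ z, sqErr j (softmax b (b • basisVec B j + z)) ∂stdGauss B ≤
      ∑ j, ∫ z, sqErr j (softmax a (a • basisVec B j + z)) ∂stdGauss B := by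
  set c := a / b with hc
  have hc0 : 0 ≤ c := div_nonneg ha hb.le
  have hc1 : c ≤ 1 := div_le_one_of_le₀ hab hb.le
  have hcb : c * b = a := div_mul_cancel₀ a hb.ne'
  set d := √(1 - c ^ 2) with hd
  have hcd : c ^ 2 + d ^ 2 = 1 := by
    rw [hd, Real.sq_sqrt (by nlinarith)]
    ring
  let F (j : Fin B) (p : (Fin B → ℝ) × (Fin B → ℝ)) : ℝ :=
    sqErr j (softmax a (c • (b • basisVec B j + p.1) + d • p.2))
  have hF (j : Fin B) : Integrable (F j) ((stdGauss B).prod (stdGauss B)) :=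
    Integrable.of_bound (C := 4 * B) (by fun_prop)
      (ae_of_all _ fun p => abs_sqErr_le j fun i => abs_softmax_le_one a _ i)
  have hint (j : Fin B) : ∫ z, sqErr j (softmax a (a • basisVec B j + z)) ∂stdGauss B =
      ∫ w, ∫ z, F j (z, w) ∂stdGauss B ∂stdGauss B := by
    rw [← integral_prod_symm _ (hF j)]
    conv_lhs => rw [← map_prod_stdGauss B hcd]
    rw [integral_map (by fun_prop) (Measurable.aestronglyMeasurable (by fun_prop))]
    refine integral_congr_ae (ae_of_all _ fun p => ?_)
    simp only [F]
    rw [smul_add, smul_smul, hcb, add_assoc]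
  rw [Finset.sum_congr rfl fun j _ => hint j,
    ← integral_finsetSum _ fun j _ => (hF j).integral_prod_right]
  calc _ = ∫ _w, ∑ j, ∫ z, sqErr j (softmax b (b • basisVec B j + z)) ∂stdGauss B
        ∂stdGauss B := by simp
    _ ≤ _ := integral_mono (integrable_const _)
        (integrable_finsetSum _ fun j _ => (hF j).integral_prod_right) fun w =>
          sum_integral_sqErr_softmax_le b (h := fun y => softmax a (c • y + d • w))
            (by fun_prop) fun y i => abs_softmax_le_one a _ i

lemma mmseB_eq {B : ℕ} (hB : 2 ≤ B) (Sn : ℝ) :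
    mmseB B Sn = (B : ℝ)⁻¹ * ∑ j, ∫ z, sqErr j (softmax (√(Real.logb 2 B) / Sn)
      ((√(Real.logb 2 B) / Sn) • basisVec B j + z)) ∂stdGauss B := by
  simp only [mmseB, sqErr, denoiser_eq_softmax hB]

lemma monotoneOn_mmseB {B : ℕ} (hB : 2 ≤ B) : MonotoneOn (mmseB B) (Set.Ioi 0) := by
  intro S hS T hT hST
  have hL : 0 < √(Real.logb 2 B) := Real.sqrt_pos.2 <|
    Real.logb_pos one_lt_two (by exact_mod_cast (by lia : 1 < B))
  rw [mmseB_eq hB, mmseB_eq hB]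
  exact mul_le_mul_of_nonneg_left (sum_integral_sqErr_softmax_anti (div_pos hL hT).le
    (div_pos hL hS) (div_le_div_of_nonneg_left hL.le hS hST)) (by positivity)

/-- the underlying SE operator is monotone; equivalently, the MMSE of
the effective `B`-dimensional Gaussian channel is nondecreasing in the noise level. -/
theorem Tu_monotone
    (B : ℕ) (hB : 2 ≤ B) (R σ2 : ℝ) (hR : 0 < R) (hσ2 : 0 < σ2) :
    (∀ E G : ℝ, 0 ≤ E → E ≤ G → Tu B R σ2 E ≤ Tu B R σ2 G) ∧
    MonotoneOn (mmseB B) (Set.Ioi (0:ℝ)) := by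
  refine ⟨fun E G hE hEG => ?_, monotoneOn_mmseB hB⟩
  have hpos : 0 < R * (σ2 + E) := by positivity
  have hle : R * (σ2 + E) ≤ R * (σ2 + G) := by gcongr
  exact monotoneOn_mmseB hB (Real.sqrt_pos.2 hpos) (Real.sqrt_pos.2 (hpos.trans_le hle))
    (Real.sqrt_le_sqrt hle)
end
end
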